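/- Let 0 < γ ≤ 1/2000. There exists n' = n'(γ) ∈ ℕ such that the following holds. Suppose H is a 3-graph on n ≥ n' vertices and t is an integer with 1 ≤ t ≤ (1 − √(2/3))·n, and H has degree sequence d₁ ≤ … ≤ dₙ with dᵢ ≥ (1/3 + γ)·C(n,2) for 1 ≤ i ≤ t, dᵢ ≥ (4/9 + γ)·C(n,2) for t < i ≤ n/3, and dᵢ ≥ (5/9)·C(n,2) for i > n/3. Then there exists a matching M in H of size at most γ⁴n/3 such that for any set W ⊆ V(H) \ V(M) with |W| divisible by 3, |W| ≤ γ⁸n, and at least (2/3)·|W| vertices of W having degree at least (5/9)·C(n,2), there exists a matching in H covering precisely the vertices V(M) ∪ W. -/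

import Mathlib

open Finset
open scoped Classical

noncomputable section

/-- The degree of a vertex `v` in a `3`-graph `H` on `Fin n`. -/
def deg {n : ℕ} (H : Finset (Finset (Fin n))) (v : Fin n) : ℕ :=
  (H.filter fun e => v ∈ e).card

/-- `H` is a `3`-graph: every edge has exactly three vertices. -/
def Is3Graph (n : ℕ) (H : Finset (Finset (Fin n))) : Prop :=
  ∀ e ∈ H, e.card = 3

/-- `M` is a matching in `H`. -/
def IsMatching {n : ℕ} (H M : Finset (Finset (Fin n))) : Prop :=
  M ⊆ H ∧ ∀ e ∈ M, ∀ f ∈ M, e ≠ f → Disjoint e f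

/-- The set of vertices covered by a collection `M` of edges. -/
def cover {n : ℕ} (M : Finset (Finset (Fin n))) : Finset (Fin n) :=
  M.biUnion id

/-- `σ` witnesses the degree sequence condition of the absorbing lemma:
`σ` is a monotone-degree ordering of the vertices and, writing `dᵢ = deg (σ i)`
(1-based positions), `dᵢ ≥ (1/3 + γ)·C(n,2)` for `1 ≤ i ≤ t`,
`dᵢ ≥ (4/9 + γ)·C(n,2)` for `t < i ≤ n/3`, and `dᵢ ≥ (5/9)·C(n,2)` for `i > n/3`. -/
def DegSeqAbs {n : ℕ} (γ : ℝ) (t : ℕ) (H : Finset (Finset (Fin n)))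
    (σ : Fin n ≃ Fin n) : Prop :=
  Monotone (fun i => deg H (σ i)) ∧
  ∀ i : Fin n,
    ((i : ℕ) + 1 ≤ t →
      ((1 : ℝ)/3 + γ) * (n.choose 2) ≤ (deg H (σ i) : ℝ)) ∧
    (t < (i : ℕ) + 1 → 3 * ((i : ℕ) + 1) ≤ n →
      ((4 : ℝ)/9 + γ) * (n.choose 2) ≤ (deg H (σ i) : ℝ)) ∧
    (n < 3 * ((i : ℕ) + 1) →
      ((5 : ℝ)/9) * (n.choose 2) ≤ (deg H (σ i) : ℝ))

/-! ### A greedy selection of disjoint objects -/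

/-- Suppose every test `x ∈ T` is passed by a `β`-proportion of the objects of `S`, even after
deleting all objects that meet a given set of at most `d * m` points. Then `m` pairwise disjoint
objects can be selected so that the potential `∑ x, 2 ^ (-#hits of x)` decays geometrically. -/
lemma exists_disjoint_family {Ω X V : Type*} [DecidableEq Ω] [DecidableEq V]
    (S : Finset Ω) (T : Finset X) (hT : T.Nonempty) (R : X → Ω → Prop) (vs : Ω → Finset V)
    (d m : ℕ) (hd : ∀ ω ∈ S, (vs ω).card ≤ d) (hpos : ∀ ω ∈ S, (vs ω).Nonempty)
    (K β : ℝ) (hKS : (S.card : ℝ) ≤ K) (hβ : 0 < β) (hK : 0 < K)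
    (h : ∀ U : Finset V, U.card ≤ d * m → ∀ x ∈ T,
      β * K ≤ ((S.filter fun ω => R x ω ∧ Disjoint (vs ω) U).card : ℝ)) :
    ∀ j ≤ m, ∃ F ⊆ S, F.card = j ∧
      (∀ ω ∈ F, ∀ ω' ∈ F, ω ≠ ω' → Disjoint (vs ω) (vs ω')) ∧
      ∑ x ∈ T, (1 / 2 : ℝ) ^ (F.filter (R x)).card ≤ T.card * (1 - β / 2) ^ j := by
  intro j
  induction j with
  | zero =>
    intro _
    exact ⟨∅, by simp, by simp, by simp, by simp⟩
  | succ j ih =>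
    intro hj
    obtain ⟨F, hFS, hFc, hFd, hFsum⟩ := ih (by omega)
    set U := F.biUnion vs with hU
    have hUc : U.card ≤ d * m := by
      calc U.card ≤ F.card * d := card_biUnion_le_card_mul _ _ _ fun ω hω => hd ω (hFS hω)
        _ ≤ m * d := Nat.mul_le_mul_right _ (by omega)
        _ = d * m := mul_comm _ _
    set S' := S.filter fun ω => Disjoint (vs ω) U with hS'
    have hcount : ∀ x ∈ T, β * S'.card ≤ ((S'.filter (R x)).card : ℝ) := by
      intro x hx
      have h1 := h U hUc x hx
      have h2 : S'.filter (R x) = S.filter fun ω => R x ω ∧ Disjoint (vs ω) U := by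
        ext ω
        simp only [hS', mem_filter]
        tauto
      have h3 : (S'.card : ℝ) ≤ K :=
        le_trans (by exact_mod_cast card_le_card (filter_subset _ _)) hKS
      rw [h2]
      exact le_trans (mul_le_mul_of_nonneg_left h3 hβ.le) h1
    have hS'ne : S'.Nonempty := by
      obtain ⟨x, hx⟩ := hT
      have h1 := h U hUc x hx
      have h2 : 0 < (S.filter fun ω => R x ω ∧ Disjoint (vs ω) U).card := by
        exact_mod_cast lt_of_lt_of_le (mul_pos hβ hK) h1
      obtain ⟨ω, hω⟩ := card_pos.1 h2
      simp only [mem_filter] at hω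
      exact ⟨ω, mem_filter.2 ⟨hω.1, hω.2.2⟩⟩
    set Φ : X → ℝ := fun x => (1 / 2 : ℝ) ^ (F.filter (R x)).card with hΦ
    have hΦ0 : ∀ x, 0 ≤ Φ x := fun x => by positivity
    have hswap : ∑ ω ∈ S', ∑ x ∈ T, Φ x * (if R x ω then 1 / 2 else 1)
        ≤ ∑ _ω ∈ S', (∑ x ∈ T, Φ x) * (1 - β / 2) := by
      rw [sum_comm, sum_const, nsmul_eq_mul, sum_mul, mul_sum]
      refine sum_le_sum fun x hx => ?_
      have h1 : ∑ ω ∈ S', (if R x ω then (1 / 2 : ℝ) else 1)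
          = S'.card - (S'.filter (R x)).card / 2 := by
        have : ∀ ω, (if R x ω then (1 / 2 : ℝ) else 1) = 1 - (if R x ω then 1 else 0) / 2 := by
          intro ω
          split_ifs <;> norm_num
        simp only [this, sum_sub_distrib, ← sum_div, sum_boole]
        simp
      rw [← mul_sum, h1]
      have h2 := mul_le_mul_of_nonneg_left (hcount x hx) (hΦ0 x)
      linarith
    obtain ⟨ω, hωS', hω⟩ := exists_le_of_sum_le hS'ne hswap
    have hωS : ω ∈ S := (mem_filter.1 hωS').1
    have hωU : Disjoint (vs ω) U := (mem_filter.1 hωS').2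
    have hωd : ∀ ω' ∈ F, Disjoint (vs ω) (vs ω') := fun ω' hω' =>
      hωU.mono_right (subset_biUnion_of_mem vs hω')
    have hωF : ω ∉ F := fun hmem =>
      (hpos ω hωS).ne_empty (disjoint_self_iff_empty _ |>.1 (hωd ω hmem))
    refine ⟨insert ω F, insert_subset hωS hFS, by rw [card_insert_of_notMem hωF, hFc], ?_, ?_⟩
    · intro ω₁ h₁ ω₂ h₂ hne
      rcases mem_insert.1 h₁ with rfl | h₁' <;> rcases mem_insert.1 h₂ with rfl | h₂'
      · exact absurd rfl hne
      · exact hωd _ h₂'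
      · exact (hωd _ h₁').symm
      · exact hFd _ h₁' _ h₂' hne
    · have hβ1 : 0 ≤ 1 - β / 2 := by
        obtain ⟨x, hx⟩ := hT
        have h1 := hcount x hx
        have h2 : ((S'.filter (R x)).card : ℝ) ≤ S'.card := by
          exact_mod_cast card_le_card (filter_subset _ _)
        have h3 : (0 : ℝ) < S'.card := by exact_mod_cast card_pos.2 hS'ne
        have h4 : β ≤ 1 := by
          by_contra! hlt
          nlinarith
        linarith
      calc ∑ x ∈ T, (1 / 2 : ℝ) ^ ((insert ω F).filter (R x)).card
          = ∑ x ∈ T, Φ x * (if R x ω then 1 / 2 else 1) := by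
            refine sum_congr rfl fun x _ => ?_
            rw [filter_insert]
            split_ifs with hR
            · rw [card_insert_of_notMem (fun hm => hωF (mem_filter.1 hm).1), pow_succ]
            · rw [mul_one]
        _ ≤ (∑ x ∈ T, Φ x) * (1 - β / 2) := hω
        _ ≤ (T.card * (1 - β / 2) ^ j) * (1 - β / 2) :=
            mul_le_mul_of_nonneg_right hFsum hβ1
        _ = T.card * (1 - β / 2) ^ (j + 1) := by ring

/-! ### Elementary counting -/

lemma card_add_card_le_of_subset {α : Type*} [DecidableEq α] {A B C : Finset α}
    (hA : A ⊆ C) (hB : B ⊆ C) : A.card + B.card ≤ C.card + (A ∩ B).card := by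
  rw [← card_union_add_card_inter]
  exact Nat.add_le_add_right (card_le_card (union_subset hA hB)) _

lemma mul_le_card_of_fibers {α β : Type*} [DecidableEq α] [Fintype β]
    (S : Finset (α × β)) (Q : Finset α) (q r : ℝ) (hr : 0 ≤ r) (hQ : q ≤ Q.card)
    (h : ∀ a ∈ Q, r ≤ ((univ.filter fun b => (a, b) ∈ S).card : ℝ)) :
    q * r ≤ S.card := by
  have h1 : ∑ a ∈ Q, (univ.filter fun b => (a, b) ∈ S).card ≤ S.card := by
    rw [← card_sigma]
    refine card_le_card_of_injOn (fun p => (p.1, p.2)) ?_ ?_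
    · rintro ⟨a, b⟩ hp
      have := (mem_sigma.1 (mem_coe.1 hp)).2
      simpa using this
    · rintro ⟨a, b⟩ _ ⟨a', b'⟩ _ hp
      simp only [Prod.mk.injEq] at hp
      obtain ⟨rfl, rfl⟩ := hp
      rfl
  calc q * r ≤ Q.card * r := mul_le_mul_of_nonneg_right hQ hr
    _ = ∑ _a ∈ Q, r := by simp
    _ ≤ ∑ a ∈ Q, ((univ.filter fun b => (a, b) ∈ S).card : ℝ) := sum_le_sum h
    _ ≤ S.card := by exact_mod_cast h1

lemma card_le_card_filter_avoid {V : Type*} [Fintype V] [DecidableEq V]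
    (Q : Finset (V × V)) (U : Finset V) :
    Q.card ≤ (Q.filter fun p => p.1 ∉ U ∧ p.2 ∉ U).card + 2 * U.card * Fintype.card V := by
  have h1 : Q ⊆ (Q.filter fun p => p.1 ∉ U ∧ p.2 ∉ U) ∪ (U ×ˢ univ ∪ univ ×ˢ U) := by
    intro p hp
    simp only [mem_union, mem_filter, mem_product, mem_univ]
    tauto
  have h2 := card_le_card h1
  have h3 := card_union_le (Q.filter fun p => p.1 ∉ U ∧ p.2 ∉ U) (U ×ˢ univ ∪ univ ×ˢ U)
  have h4 := card_union_le (U ×ˢ (univ : Finset V)) (univ ×ˢ U)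
  rw [card_product, card_product, card_univ] at h4
  linarith

/-! ### Links -/

/-- The link of `v`, as a set of ordered pairs. -/
def link {n : ℕ} (H : Finset (Finset (Fin n))) (v : Fin n) : Finset (Fin n × Fin n) :=
  univ.filter fun p => {v, p.1, p.2} ∈ H

lemma mem_link {n : ℕ} {H : Finset (Finset (Fin n))} {v : Fin n} {p : Fin n × Fin n} :
    p ∈ link H v ↔ {v, p.1, p.2} ∈ H := by
  simp [link]

lemma Is3Graph.ne {n : ℕ} {H : Finset (Finset (Fin n))} (hH : Is3Graph n H) {a b c : Fin n}
    (h : {a, b, c} ∈ H) : a ≠ b ∧ a ≠ c ∧ b ≠ c := by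
  have h3 := hH _ h
  refine ⟨?_, ?_, ?_⟩ <;> rintro rfl
  · rw [insert_eq_of_mem (mem_insert_self _ _)] at h3
    exact absurd (card_le_two (a := a) (b := c)) (by omega)
  · rw [insert_eq_of_mem (mem_insert_of_mem (mem_singleton_self _))] at h3
    exact absurd (card_le_two (a := b) (b := a)) (by omega)
  · rw [insert_eq_of_mem (mem_singleton_self b)] at h3
    exact absurd (card_le_two (a := a) (b := b)) (by omega)

lemma link_subset_offDiag {n : ℕ} {H : Finset (Finset (Fin n))} (hH : Is3Graph n H)
    (v : Fin n) : link H v ⊆ (univ : Finset (Fin n)).offDiag := by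
  intro p hp
  simpa using (hH.ne (mem_link.1 hp)).2.2

lemma two_mul_deg_le_card_link {n : ℕ} {H : Finset (Finset (Fin n))} (hH : Is3Graph n H)
    (v : Fin n) : 2 * deg H v ≤ (link H v).card := by
  have hmap : ∀ p ∈ link H v, ({v, p.1, p.2} : Finset (Fin n)) ∈ H.filter fun e => v ∈ e := by
    intro p hp
    exact mem_filter.2 ⟨mem_link.1 hp, by simp⟩
  rw [card_eq_sum_card_fiberwise hmap, deg, mul_comm, ← smul_eq_mul]
  refine card_nsmul_le_sum _ _ _ fun e he => ?_
  obtain ⟨heH, hve⟩ := mem_filter.1 he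
  have hc : (e.erase v).card = 2 := by
    rw [card_erase_of_mem hve, hH e heH]
  obtain ⟨p, q, hpq, hpqe⟩ := card_eq_two.1 hc
  have he' : e = {v, p, q} := by rw [← insert_erase hve, hpqe]
  have he'' : e = {v, q, p} := by rw [he', pair_comm]
  have hsub : ({(p, q), (q, p)} : Finset (Fin n × Fin n)) ⊆
      (link H v).filter fun r => ({v, r.1, r.2} : Finset (Fin n)) = e := by
    intro r hr
    rcases mem_insert.1 hr with rfl | hr
    · exact mem_filter.2 ⟨mem_link.2 (he' ▸ heH), he'.symm⟩
    · rw [mem_singleton.1 hr]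
      exact mem_filter.2 ⟨mem_link.2 (he'' ▸ heH), he''.symm⟩
  have h2 : ({(p, q), (q, p)} : Finset (Fin n × Fin n)).card = 2 :=
    card_pair (by simp [hpq])
  exact h2 ▸ card_le_card hsub

lemma cast_card_offDiag {V : Type*} [DecidableEq V] (s : Finset V) :
    (s.offDiag.card : ℝ) = s.card * (s.card - 1) := by
  rw [offDiag_card, Nat.cast_sub (Nat.le_mul_self _)]
  push_cast
  ring

/-- The link of `v` meets any set of pairs in as many pairs as the sizes force, even when a few
vertices are forbidden. -/
lemma card_link_inter_avoid {n : ℕ} {H : Finset (Finset (Fin n))} (hH : Is3Graph n H)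
    (v : Fin n) (Q : Finset (Fin n × Fin n)) (hQ : Q ⊆ (univ : Finset (Fin n)).offDiag)
    (U : Finset (Fin n)) :
    2 * (deg H v : ℝ) + Q.card - n * (n - 1) - 2 * U.card * n ≤
      ((link H v ∩ Q).filter fun p => p.1 ∉ U ∧ p.2 ∉ U).card := by
  have h1 := card_add_card_le_of_subset (link_subset_offDiag hH v) hQ
  have h2 := card_le_card_filter_avoid (link H v ∩ Q) U
  have h3 := two_mul_deg_le_card_link hH v
  have h4 := cast_card_offDiag (univ : Finset (Fin n))
  rw [card_univ, Fintype.card_fin] at h4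
  rw [Fintype.card_fin] at h2
  have h1' : ((link H v).card : ℝ) + Q.card ≤
      (univ : Finset (Fin n)).offDiag.card + (link H v ∩ Q).card := by exact_mod_cast h1
  have h2' : ((link H v ∩ Q).card : ℝ) ≤
      ((link H v ∩ Q).filter fun p => p.1 ∉ U ∧ p.2 ∉ U).card + 2 * U.card * n := by
    exact_mod_cast h2
  have h3' : 2 * (deg H v : ℝ) ≤ (link H v).card := by exact_mod_cast h3
  linarith

/-! ### Matchings -/

lemma IsMatching.insert_edge {n : ℕ} {H M : Finset (Finset (Fin n))} (hM : IsMatching H M)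
    {e : Finset (Fin n)} (he : e ∈ H) (hd : Disjoint e (cover M)) :
    IsMatching H (insert e M) := by
  have hd' : ∀ f ∈ M, Disjoint e f := fun f hf =>
    hd.mono_right (subset_biUnion_of_mem id hf)
  refine ⟨insert_subset he hM.1, ?_⟩
  intro f₁ h₁ f₂ h₂ hne
  rcases mem_insert.1 h₁ with rfl | h₁' <;> rcases mem_insert.1 h₂ with rfl | h₂'
  · exact absurd rfl hne
  · exact hd' _ h₂'
  · exact (hd' _ h₁').symm
  · exact hM.2 _ h₁' _ h₂' hne

lemma cover_insert {n : ℕ} (e : Finset (Fin n)) (M : Finset (Finset (Fin n))) :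
    cover (insert e M) = e ∪ cover M := by
  simp [cover, biUnion_insert]

/-! ### Absorbers -/

/-- A candidate absorber: `((a, b), (y₁, y₂), (z₁, z₂))`. -/
abbrev Gadget (n : ℕ) : Type := (Fin n × Fin n) × (Fin n × Fin n) × (Fin n × Fin n)

/-- The edge `a y₁ y₂`. -/
def Gadget.left {n : ℕ} (ω : Gadget n) : Finset (Fin n) := {ω.1.1, ω.2.1.1, ω.2.1.2}

/-- The edge `b z₁ z₂`. -/
def Gadget.right {n : ℕ} (ω : Gadget n) : Finset (Fin n) := {ω.1.2, ω.2.2.1, ω.2.2.2}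

/-- The vertices of a candidate absorber. -/
def Gadget.verts {n : ℕ} (ω : Gadget n) : Finset (Fin n) := Gadget.left ω ∪ Gadget.right ω

/-- The two edges of the absorber are present and disjoint. -/
def Gadget.Valid {n : ℕ} (H : Finset (Finset (Fin n))) (ω : Gadget n) : Prop :=
  Gadget.left ω ∈ H ∧ Gadget.right ω ∈ H ∧ Disjoint (Gadget.left ω) (Gadget.right ω)

/-- The absorber can be rearranged to cover `x`, `y` and `z` too. -/
def Gadget.Absorbs {n : ℕ} (H : Finset (Finset (Fin n))) (x : Fin n × Fin n × Fin n)
    (ω : Gadget n) : Prop :=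
  {x.1, ω.1.1, ω.1.2} ∈ H ∧ {x.2.1, ω.2.1.1, ω.2.1.2} ∈ H ∧ {x.2.2, ω.2.2.1, ω.2.2.2} ∈ H

lemma Gadget.card_verts_le {n : ℕ} (ω : Gadget n) : (Gadget.verts ω).card ≤ 6 :=
  (card_union_le _ _).trans (Nat.add_le_add card_le_three card_le_three)

lemma Gadget.verts_nonempty {n : ℕ} (ω : Gadget n) : (Gadget.verts ω).Nonempty :=
  ⟨ω.1.1, by simp [Gadget.verts, Gadget.left]⟩

lemma exists_matching_of_family {n : ℕ} {H : Finset (Finset (Fin n))} (F : Finset (Gadget n))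
    (hv : ∀ ω ∈ F, Gadget.Valid H ω)
    (hd : ∀ ω ∈ F, ∀ ω' ∈ F, ω ≠ ω' → Disjoint (Gadget.verts ω) (Gadget.verts ω')) :
    ∃ M, IsMatching H M ∧ cover M = F.biUnion Gadget.verts ∧ M.card ≤ 2 * F.card := by
  induction F using Finset.induction_on with
  | empty => exact ⟨∅, by simp [IsMatching], by simp [cover], by simp⟩
  | insert ω F hω ih =>
    obtain ⟨M, hM, hcov, hcard⟩ := ih (fun ω' h => hv ω' (mem_insert_of_mem h))
      (fun a ha b hb => hd a (mem_insert_of_mem ha) b (mem_insert_of_mem hb))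
    obtain ⟨hl, hr, hlr⟩ := hv ω (mem_insert_self _ _)
    have hdF : Disjoint (Gadget.verts ω) (cover M) := by
      rw [hcov, disjoint_biUnion_right]
      intro ω' hω'
      exact hd ω (mem_insert_self _ _) ω' (mem_insert_of_mem hω') (by rintro rfl; exact hω hω')
    rw [Gadget.verts, disjoint_union_left] at hdF
    have hM₁ := hM.insert_edge hr hdF.2
    have hM₂ := hM₁.insert_edge hl (by
      rw [cover_insert, disjoint_union_right]
      exact ⟨hlr, hdF.1⟩)
    refine ⟨_, hM₂, ?_, ?_⟩
    · rw [cover_insert, cover_insert, hcov, biUnion_insert, Gadget.verts, union_assoc]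
    · have h1 := card_insert_le (Gadget.left ω) (insert (Gadget.right ω) M)
      have h2 := card_insert_le (Gadget.right ω) M
      rw [card_insert_of_notMem hω]
      omega

/-- If every admissible triple has at least `r` absorbers in the family, then any admissible set
of `3 * r` further vertices can be absorbed. -/
lemma exists_matching_absorbing {n : ℕ} {H : Finset (Finset (Fin n))} (hH : Is3Graph n H)
    (L : Finset (Fin n)) (r : ℕ) : ∀ (F : Finset (Gadget n)) (W : Finset (Fin n)),
    (∀ ω ∈ F, Gadget.Valid H ω) →
    (∀ ω ∈ F, ∀ ω' ∈ F, ω ≠ ω' → Disjoint (Gadget.verts ω) (Gadget.verts ω')) →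
    (∀ ω ∈ F, Disjoint (Gadget.verts ω) W) →
    W.card = 3 * r → 2 * r ≤ (W ∩ L).card →
    (∀ x, ∀ y ∈ L, ∀ z ∈ L, r ≤ (F.filter (Gadget.Absorbs H (x, y, z))).card) →
    ∃ M, IsMatching H M ∧ cover M = F.biUnion Gadget.verts ∪ W := by
  induction r with
  | zero =>
    intro F W hv hd _ hW _ _
    obtain ⟨M, hM, hcov, _⟩ := exists_matching_of_family F hv hd
    exact ⟨M, hM, by rw [hcov, card_eq_zero.1 hW, union_empty]⟩
  | succ r ih =>
    intro F W hv hd hdW hW hWL habs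
    obtain ⟨y, hy, z, hz, hyz⟩ := one_lt_card.1 (show 1 < (W ∩ L).card by omega)
    have hxex : ∃ x ∈ W, x ≠ y ∧ x ≠ z ∧ 2 * r ≤ (((W.erase x).erase y).erase z ∩ L).card := by
      have hyzWL : ({y, z} : Finset (Fin n)) ⊆ W ∩ L := by
        intro v hv
        rcases mem_insert.1 hv with rfl | hv
        · exact hy
        · rw [mem_singleton.1 hv]
          exact hz
      by_cases hsub : W ⊆ L
      · have hlt : ({y, z} : Finset (Fin n)).card < W.card := by
          have := card_le_two (a := y) (b := z)
          omega
        obtain ⟨x, hxW, hx⟩ := exists_mem_notMem_of_card_lt_card hlt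
        simp only [mem_insert, mem_singleton, not_or] at hx
        refine ⟨x, hxW, hx.1, hx.2, ?_⟩
        rw [inter_eq_left.2 (((erase_subset _ _).trans
          ((erase_subset _ _).trans (erase_subset _ _))).trans hsub)]
        have h1 := pred_card_le_card_erase (s := W) (a := x)
        have h2 := pred_card_le_card_erase (s := W.erase x) (a := y)
        have h3 := pred_card_le_card_erase (s := (W.erase x).erase y) (a := z)
        omega
      · obtain ⟨x, hxW, hxL⟩ := not_subset.1 hsub
        refine ⟨x, hxW, ?_, ?_, ?_⟩
        · rintro rfl
          exact hxL (mem_inter.1 hy).2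
        · rintro rfl
          exact hxL (mem_inter.1 hz).2
        · have heq : ((W.erase x).erase y).erase z ∩ L = ((W ∩ L).erase y).erase z := by
            ext v
            simp only [mem_inter, mem_erase]
            constructor
            · tauto
            · rintro ⟨h1, h2, h3, h4⟩
              exact ⟨⟨h1, h2, fun h => hxL (h ▸ h4), h3⟩, h4⟩
          rw [heq]
          have h2 := pred_card_le_card_erase (s := W ∩ L) (a := y)
          have h3 := pred_card_le_card_erase (s := (W ∩ L).erase y) (a := z)
          omega
    obtain ⟨x, hxW, hxy, hxz, hcard⟩ := hxex
    have hyW := (mem_inter.1 hy).1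
    have hzW := (mem_inter.1 hz).1
    obtain ⟨ω, hω⟩ := card_pos.1 (lt_of_lt_of_le (Nat.succ_pos r)
      (habs x y (mem_inter.1 hy).2 z (mem_inter.1 hz).2))
    obtain ⟨hωF, hωx, hωy, hωz⟩ := mem_filter.1 hω
    set W' := ((W.erase x).erase y).erase z with hW'
    have hW'sub : W' ⊆ W := (erase_subset _ _).trans ((erase_subset _ _).trans (erase_subset _ _))
    have hW'c : W'.card = 3 * r := by
      rw [hW', card_erase_of_mem, card_erase_of_mem, card_erase_of_mem hxW, hW]
      · omega
      · exact mem_erase.2 ⟨hxy.symm, hyW⟩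
      · exact mem_erase.2 ⟨hyz.symm, mem_erase.2 ⟨hxz.symm, hzW⟩⟩
    obtain ⟨M, hM, hcov⟩ := ih (F.erase ω) W' (fun a ha => hv a (mem_of_mem_erase ha))
      (fun a ha b hb => hd a (mem_of_mem_erase ha) b (mem_of_mem_erase hb))
      (fun a ha => (hdW a (mem_of_mem_erase ha)).mono_right hW'sub) hW'c hcard
      (fun x y hy z hz => by
        have h1 := habs x y hy z hz
        have h2 := pred_card_le_card_erase (s := F.filter (Gadget.Absorbs H (x, y, z))) (a := ω)
        rw [filter_erase]
        omega)
    obtain ⟨⟨a, b⟩, ⟨p, q⟩, ⟨s, t⟩⟩ := ω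
    obtain ⟨hl, hr, hlr⟩ := hv _ hωF
    have hωW := hdW _ hωF
    have hωM : Disjoint ({a, b, p, q, s, t, x, y, z} : Finset (Fin n)) (cover M) := by
      rw [hcov, disjoint_union_right, disjoint_biUnion_right]
      constructor
      · intro ω' hω'
        have h1 := hd _ hωF ω' (mem_of_mem_erase hω') (ne_of_mem_erase hω').symm
        have h2 := hdW ω' (mem_of_mem_erase hω')
        rw [disjoint_left] at h1 h2 ⊢
        intro v hv hv'
        simp only [mem_insert, mem_singleton] at hv
        have hvW := h2 hv'
        have hvω := fun h => h1 h hv'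
        simp only [Gadget.verts, Gadget.left, Gadget.right, mem_union, mem_insert,
          mem_singleton] at hvω
        rcases hv with h | h | h | h | h | h | h | h | h
        all_goals first
          | exact hvω (by tauto)
          | exact hvW (h ▸ ‹_›)
      · rw [disjoint_left] at hωW ⊢
        intro v hv hv'
        have hvω := fun h => hωW h (hW'sub hv')
        simp only [Gadget.verts, Gadget.left, Gadget.right, mem_union, mem_insert,
          mem_singleton] at hvω
        simp only [mem_insert, mem_singleton] at hv
        simp only [hW', mem_erase] at hv'
        tauto
    have hxn := hH.ne hωx
    have hyn := hH.ne hωy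
    have hzn := hH.ne hωz
    have hln := hH.ne hl
    have hrn := hH.ne hr
    simp only [Gadget.left, Gadget.right, Gadget.verts, disjoint_union_left, disjoint_insert_left,
      disjoint_singleton_left, mem_insert, mem_singleton, not_or]
      at hlr hωW hxn hyn hzn hln hrn hωx hωy hωz
    have hne : ∀ v ∈ W, ∀ u, u ∉ W → v ≠ u := fun v hv u hu h => hu (h ▸ hv)
    obtain ⟨⟨haW, hpW, hqW⟩, hbW, hsW, htW⟩ := hωW
    simp only [disjoint_insert_left, disjoint_singleton_left] at hωM
    have hM₁ := hM.insert_edge hωz (by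
      simp only [disjoint_insert_left, disjoint_singleton_left]
      tauto)
    have hM₂ := hM₁.insert_edge hωy (by
      rw [cover_insert]
      simp only [disjoint_insert_left, disjoint_singleton_left, mem_union, mem_insert,
        mem_singleton, not_or]
      have h1 := hne y hyW s hsW
      have h2 := hne y hyW t htW
      have h3 := (hne z hzW p hpW).symm
      have h4 := (hne z hzW q hqW).symm
      tauto)
    have hM₃ := hM₂.insert_edge hωx (by
      rw [cover_insert, cover_insert]
      simp only [disjoint_insert_left, disjoint_singleton_left, mem_union, mem_insert,
        mem_singleton, not_or]
      have h1 := hne x hxW s hsW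
      have h2 := hne x hxW t htW
      have h3 := hne x hxW p hpW
      have h4 := hne x hxW q hqW
      have h5 := (hne z hzW a haW).symm
      have h6 := (hne z hzW b hbW).symm
      have h7 := (hne y hyW a haW).symm
      have h8 := (hne y hyW b hbW).symm
      have h9 : b ≠ p := fun h => hlr.2.1.1 h.symm
      have h10 : b ≠ q := fun h => hlr.2.2.1 h.symm
      tauto)
    refine ⟨_, hM₃, ?_⟩
    have hFω : F.biUnion Gadget.verts =
        Gadget.verts ((a, b), (p, q), (s, t)) ∪ (F.erase ((a, b), (p, q), (s, t))).biUnion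
          Gadget.verts := by
      rw [← biUnion_insert, insert_erase hωF]
    have hWx : W = {x, y, z} ∪ W' := by
      ext v
      simp only [hW', mem_union, mem_insert, mem_singleton, mem_erase]
      constructor
      · tauto
      · rintro ((rfl | rfl | rfl) | h)
        exacts [hxW, hyW, hzW, h.2.2.2]
    rw [cover_insert, cover_insert, cover_insert, hcov, hFω, hWx]
    simp only [Gadget.verts, Gadget.left, Gadget.right, insert_eq]
    ac_rfl

/-- The number of absorbers for a triple that avoid a given vertex set `U`, where `B` is a set
containing all vertices of low degree. -/
lemma card_absorbers_ge {n : ℕ} {H : Finset (Finset (Fin n))} (hH : Is3Graph n H)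
    (B U : Finset (Fin n)) (x y z : Fin n) (q r : ℝ) (hr : 0 ≤ r)
    (hx : q ≤ 2 * (deg H x : ℝ) + (n - B.card) * (n - B.card - 1) - n * (n - 1)
      - 2 * U.card * n)
    (hy : ∀ a ∉ B, r ≤ 2 * (deg H a : ℝ) + 2 * deg H y - n * (n - 1) - 2 * (U.card + 4) * n)
    (hz : ∀ a ∉ B, r ≤ 2 * (deg H a : ℝ) + 2 * deg H z - n * (n - 1) - 2 * (U.card + 4) * n) :
    q * (r * r) ≤ (((univ.filter (Gadget.Valid H)).filter fun ω =>
      Gadget.Absorbs H (x, y, z) ω ∧ Disjoint (Gadget.verts ω) U).card : ℝ) := by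
  have hcommon : ∀ (v a : Fin n) (U' : Finset (Fin n)), U'.card ≤ U.card + 4 →
      r ≤ 2 * (deg H a : ℝ) + 2 * deg H v - n * (n - 1) - 2 * (U.card + 4) * n →
      r ≤ (((link H v ∩ link H a).filter fun p => p.1 ∉ U' ∧ p.2 ∉ U').card : ℝ) := by
    intro v a U' hU' h
    refine le_trans ?_ (card_link_inter_avoid hH v (link H a) (link_subset_offDiag hH a) U')
    have h1 : 2 * (deg H a : ℝ) ≤ (link H a).card := by
      exact_mod_cast two_mul_deg_le_card_link hH a
    have h2 : (U'.card : ℝ) ≤ U.card + 4 := by exact_mod_cast hU'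
    have h3 : 2 * (U'.card : ℝ) * n ≤ 2 * (U.card + 4) * n := by gcongr
    linarith
  refine mul_le_card_of_fibers _
    ((link H x ∩ Bᶜ.offDiag).filter fun p => p.1 ∉ U ∧ p.2 ∉ U) q (r * r) (by positivity) ?_ ?_
  · refine le_trans ?_ (card_link_inter_avoid hH x Bᶜ.offDiag
      (offDiag_mono (subset_univ _)) U)
    have h1 : ((Bᶜ.card : ℕ) : ℝ) = n - B.card := by
      rw [card_compl, Fintype.card_fin, Nat.cast_sub (by simpa using card_le_univ B)]
    rw [cast_card_offDiag, h1]
    linarith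
  · rintro ⟨a, b⟩ hab
    simp only [mem_filter, mem_inter, mem_link, mem_offDiag, mem_compl] at hab
    obtain ⟨⟨hxab, haB, hbB, hab⟩, haU, hbU⟩ := hab
    have hya := hcommon y a (insert b U) ((card_insert_le _ _).trans (by omega)) (hy a haB)
    refine mul_le_card_of_fibers _ _ r r hr hya ?_
    rintro ⟨p, q⟩ hpq
    simp only [mem_filter, mem_inter, mem_link, mem_insert, not_or] at hpq
    obtain ⟨⟨hypq, hapq⟩, ⟨hpb, hpU⟩, hqb, hqU⟩ := hpq
    refine le_trans (hcommon z b (insert a (insert p (insert q U))) ?_ (hz b hbB)) ?_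
    · have h1 := card_insert_le a (insert p (insert q U))
      have h2 := card_insert_le p (insert q U)
      have h3 := card_insert_le q U
      omega
    · norm_cast
      refine card_le_card ?_
      rintro ⟨s, t⟩ hst
      simp only [mem_filter, mem_inter, mem_link, mem_insert, not_or] at hst
      obtain ⟨⟨hzst, hbst⟩, ⟨hsa, hsp, hsq, hsU⟩, hta, htp, htq, htU⟩ := hst
      simp only [mem_filter, mem_univ, true_and, Gadget.Valid, Gadget.Absorbs, Gadget.verts,
        Gadget.left, Gadget.right, disjoint_union_left, disjoint_insert_left,
        disjoint_singleton_left, mem_insert, mem_singleton, not_or]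
      have e1 := Ne.symm hsa
      have e2 := Ne.symm hsp
      have e3 := Ne.symm hsq
      have e4 := Ne.symm hta
      have e5 := Ne.symm htp
      have e6 := Ne.symm htq
      tauto

/-! ### Numerical estimates -/

lemma card_mul_pow_lt_half_pow {γ : ℝ} (hγ : 0 < γ) (hγ' : γ ≤ 1 / 2000) {n m k : ℕ}
    (hn : 100 / (γ ^ 7 / 200) ^ 4 < n) (hm : γ ^ 4 * n / 6 - 1 ≤ m)
    (hk : (k : ℝ) ≤ γ ^ 8 * n / 3) :
    (n : ℝ) ^ 3 * (1 - γ ^ 3 / 8 / 2) ^ m < (1 / 2 : ℝ) ^ k := by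
  set c := γ ^ 7 / 200 with hc
  have hc0 : 0 < c := by positivity
  have hn0 : (0 : ℝ) < n := lt_trans (by positivity) hn
  have hγ3 : γ ^ 3 ≤ 1 := pow_le_one₀ hγ.le (by linarith)
  have h1 : (1 - γ ^ 3 / 8 / 2) ^ m ≤ Real.exp (-(γ ^ 3 / 16) * m) := by
    rw [mul_comm, Real.exp_nat_mul]
    refine pow_le_pow_left₀ (by linarith) ?_ m
    have := Real.add_one_le_exp (-(γ ^ 3 / 16))
    linarith
  have h2 : Real.exp (-(k : ℝ)) ≤ (1 / 2 : ℝ) ^ k := by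
    have h3 : Real.exp (-1) ≤ 1 / 2 := by
      rw [Real.exp_neg, one_div]
      refine inv_anti₀ (by norm_num) ?_
      have := Real.add_one_le_exp (1 : ℝ)
      linarith
    calc Real.exp (-(k : ℝ)) = Real.exp (-1) ^ k := by
          rw [← Real.exp_nat_mul]
          ring_nf
      _ ≤ (1 / 2 : ℝ) ^ k := pow_le_pow_left₀ (Real.exp_pos _).le h3 k
  have h4 : -(γ ^ 3 / 16) * m ≤ 1 - c * n - k := by
    have h5 := mul_le_mul_of_nonneg_left hm (show 0 ≤ γ ^ 3 / 16 by positivity)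
    have h6 : γ ^ 8 * n ≤ γ ^ 7 * n * (1 / 2000) := by
      calc γ ^ 8 * n = γ ^ 7 * n * γ := by ring
        _ ≤ γ ^ 7 * n * (1 / 2000) := by gcongr
    have h7 : 0 ≤ γ ^ 7 * n := by positivity
    have h8 : γ ^ 3 / 16 * (γ ^ 4 * n / 6 - 1) = γ ^ 7 * n / 96 - γ ^ 3 / 16 := by ring
    have h9 : c * n = γ ^ 7 * n / 200 := by rw [hc]; ring
    linarith
  have h10 : (n : ℝ) ^ 3 * Real.exp (1 - c * n) < 1 := by
    have h11 := Real.pow_div_factorial_le_exp (x := c * n) (by positivity) 4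
    have h12 : Real.exp 1 < 3 := lt_trans Real.exp_one_lt_d9 (by norm_num)
    rw [Real.exp_sub, ← mul_div_assoc, div_lt_one (Real.exp_pos _)]
    refine lt_of_lt_of_le ?_ h11
    rw [div_lt_iff₀ (by positivity)] at hn
    have h13 : ((4 : ℕ).factorial : ℝ) = 24 := by norm_num [Nat.factorial]
    rw [h13, lt_div_iff₀ (by norm_num)]
    have h14 : (n : ℝ) ^ 3 * 100 < (n : ℝ) ^ 3 * (n * c ^ 4) := by gcongr
    have h15 : (n : ℝ) ^ 3 * Real.exp 1 < (n : ℝ) ^ 3 * 3 := by gcongr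
    have h16 : 0 < (n : ℝ) ^ 3 := by positivity
    calc (n : ℝ) ^ 3 * Real.exp 1 * 24 < (n : ℝ) ^ 3 * 100 := by linarith
      _ < (n : ℝ) ^ 3 * (n * c ^ 4) := h14
      _ = (c * n) ^ 4 := by ring
  calc (n : ℝ) ^ 3 * (1 - γ ^ 3 / 8 / 2) ^ m
      ≤ (n : ℝ) ^ 3 * Real.exp (1 - c * n - k) := by
        gcongr
        exact h1.trans (Real.exp_le_exp.2 h4)
    _ = (n : ℝ) ^ 3 * Real.exp (1 - c * n) * Real.exp (-(k : ℝ)) := by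
        rw [mul_assoc, ← Real.exp_add]
        ring_nf
    _ < 1 * Real.exp (-(k : ℝ)) := mul_lt_mul_of_pos_right h10 (Real.exp_pos _)
    _ ≤ (1 / 2 : ℝ) ^ k := by rw [one_mul]; exact h2

lemma two_mul_cast_choose_two (n : ℕ) : 2 * ((n.choose 2 : ℕ) : ℝ) = n * (n - 1) := by
  rw [Nat.cast_choose_two]
  ring

/-- Every triple with two vertices of large degree has a positive proportion of absorbers avoiding
a given small vertex set. -/
lemma card_absorbers_ge_of_degrees {n : ℕ} {γ : ℝ} (hγ : 0 < γ) (hγ' : γ ≤ 1 / 2000)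
    {H : Finset (Finset (Fin n))} (hH : Is3Graph n H) (hnγ : 40 ≤ n * γ)
    (B U : Finset (Fin n)) (x y z : Fin n)
    (hBc : (B.card : ℝ) ≤ (1 - Real.sqrt (2 / 3)) * n)
    (hB : ∀ v ∉ B, ((4 : ℝ) / 9 + γ) * n.choose 2 ≤ deg H v)
    (hx : ((1 : ℝ) / 3 + γ) * n.choose 2 ≤ deg H x)
    (hy : ((5 : ℝ) / 9) * n.choose 2 ≤ deg H y)
    (hz : ((5 : ℝ) / 9) * n.choose 2 ≤ deg H z)
    (hUc : (U.card : ℝ) ≤ γ * n / 16) :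
    γ ^ 3 / 8 * (n : ℝ) ^ 6 ≤ (((univ.filter (Gadget.Valid H)).filter fun ω =>
      Gadget.Absorbs H (x, y, z) ω ∧ Disjoint (Gadget.verts ω) U).card : ℝ) := by
  have hn0 : (0 : ℝ) < n := by
    by_contra! h
    nlinarith
  have hC := two_mul_cast_choose_two n
  have hBsq : (2 : ℝ) / 3 * n ^ 2 - n ≤ (n - B.card) * (n - B.card - 1) := by
    have h2 : Real.sqrt (2 / 3) * n ≤ n - B.card := by linarith
    have h3 : (Real.sqrt (2 / 3) * n) ^ 2 ≤ ((n : ℝ) - B.card) ^ 2 :=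
      pow_le_pow_left₀ (by positivity) h2 2
    rw [mul_pow, Real.sq_sqrt (by norm_num)] at h3
    have h4 : (0 : ℝ) ≤ B.card := Nat.cast_nonneg _
    linear_combination h3 + h4
  have hUn : 2 * (U.card : ℝ) * n ≤ γ * n ^ 2 / 8 := by
    have := mul_le_mul_of_nonneg_right hUc hn0.le
    linear_combination 2 * this
  have hnn : 40 * (n : ℝ) ≤ γ * n ^ 2 := by
    have := mul_le_mul_of_nonneg_right hnγ hn0.le
    linear_combination this
  have hγn : γ * n ≤ n := by
    have := mul_le_mul_of_nonneg_right hγ' hn0.le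
    linarith
  have hlarge : ∀ v, ((5 : ℝ) / 9) * n.choose 2 ≤ deg H v → ∀ a ∉ B, γ * (n : ℝ) ^ 2 / 2 ≤
      2 * (deg H a : ℝ) + 2 * deg H v - n * (n - 1) - 2 * (U.card + 4) * n := by
    intro v h1 a ha
    have h2 := hB a ha
    have h3 : (1 + γ) * (n * (n - 1)) ≤ 2 * (deg H a : ℝ) + 2 * deg H v := by
      rw [← hC]
      linarith
    have h4 : 0 ≤ γ * (n : ℝ) ^ 2 := by positivity
    linarith [h3, hUn, hnn, hγn]
  have key := card_absorbers_ge hH B U x y z (γ * n ^ 2 / 2) (γ * n ^ 2 / 2) (by positivity)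
    (by
      have h2 : (1 / 3 + γ) * (n * (n - 1)) ≤ 2 * (deg H x : ℝ) := by
        rw [← hC]
        linarith
      have h4 : 0 ≤ γ * (n : ℝ) ^ 2 := by positivity
      linarith [h2, hUn, hnn, hγn])
    (hlarge y hy) (hlarge z hz)
  calc γ ^ 3 / 8 * (n : ℝ) ^ 6
      = γ * n ^ 2 / 2 * (γ * n ^ 2 / 2 * (γ * n ^ 2 / 2)) := by ring
    _ ≤ _ := key

/-- A degree sequence as in `DegSeqAbs` makes every vertex have degree above `1/3`, some vertex
have degree at least `5/9`, and all but a small set have degree above `4/9`. -/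
lemma DegSeqAbs.exists_low_set {n : ℕ} {γ : ℝ} (hγ : 0 < γ) (hγ' : γ ≤ 1 / 2000) {t : ℕ}
    {H : Finset (Finset (Fin n))} {σ : Fin n ≃ Fin n} (h : DegSeqAbs γ t H σ) (hn : 0 < n) :
    ∃ B : Finset (Fin n), B.card ≤ t ∧
      (∀ v ∉ B, ((4 : ℝ) / 9 + γ) * n.choose 2 ≤ deg H v) ∧
      (∀ v, ((1 : ℝ) / 3 + γ) * n.choose 2 ≤ deg H v) ∧
      ∃ v, ((5 : ℝ) / 9) * n.choose 2 ≤ deg H v := by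
  have hC : (0 : ℝ) ≤ n.choose 2 := Nat.cast_nonneg _
  have h49 : ∀ i : Fin n, t < (i : ℕ) + 1 → ((4 : ℝ) / 9 + γ) * n.choose 2 ≤ deg H (σ i) := by
    intro i hi
    by_cases hi' : 3 * ((i : ℕ) + 1) ≤ n
    · exact (h.2 i).2.1 hi hi'
    · refine le_trans ?_ ((h.2 i).2.2 (by omega))
      gcongr
      linarith
  refine ⟨(univ.filter fun i : Fin n => (i : ℕ) < t).image σ, ?_, ?_, ?_, ?_⟩
  · refine card_image_le.trans ?_
    rw [← card_range t]
    refine card_le_card_of_injOn (fun i => (i : ℕ)) ?_ (fun a _ b _ hab => Fin.ext hab)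
    intro i hi
    simpa using hi
  · intro v hv
    have := h49 (σ.symm v) (by
      by_contra! hlt
      exact hv (mem_image.2 ⟨σ.symm v, by simpa using hlt, by simp⟩))
    simpa using this
  · intro v
    rw [← σ.apply_symm_apply v]
    rcases Nat.lt_or_ge t ((σ.symm v : ℕ) + 1) with hi | hi
    · exact le_trans (mul_le_mul_of_nonneg_right (by linarith) hC) (h49 _ hi)
    · exact (h.2 _).1 hi
  · exact ⟨σ ⟨n - 1, by omega⟩, (h.2 _).2.2 (by simp; omega)⟩

/-- The absorbing lemma: for `0 < γ ≤ 1/2000` there exists `n'` such that the following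
holds.  If `H` is a `3`-graph on `n ≥ n'` vertices satisfying the degree sequence
condition `DegSeqAbs` for some `t` with `1 ≤ t ≤ (1 − √(2/3))·n`, then there is a
matching `M` in `H` of size at most `γ⁴n/3` such that for any `W ⊆ V(H) \ V(M)` with
`3 ∣ |W|`, `|W| ≤ γ⁸n` and at least `(2/3)·|W|` vertices of `W` of degree at least
`(5/9)·C(n,2)`, there is a matching covering precisely the vertices `V(M) ∪ W`. -/
theorem absorbing_lemma (γ : ℝ) (hγ : 0 < γ) (hγ' : γ ≤ 1/2000) :
    ∃ n' : ℕ, ∀ n : ℕ, n' ≤ n →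
      ∀ t : ℕ, 1 ≤ t → (t : ℝ) ≤ (1 - Real.sqrt (2/3)) * n →
      ∀ H : Finset (Finset (Fin n)), Is3Graph n H →
      (∃ σ : Fin n ≃ Fin n, DegSeqAbs γ t H σ) →
      ∃ M, IsMatching H M ∧ (M.card : ℝ) ≤ γ^4 * n / 3 ∧
        ∀ W : Finset (Fin n), W ⊆ univ \ cover M → 3 ∣ W.card →
          (W.card : ℝ) ≤ γ^8 * n →
          (2 : ℝ)/3 * W.card ≤
            ((W.filter fun v => ((5 : ℝ)/9) * (n.choose 2) ≤ (deg H v : ℝ)).card : ℝ) →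
          ∃ M', IsMatching H M' ∧ cover M' = cover M ∪ W := by
  refine ⟨⌈40 / γ⌉₊ + ⌈100 / (γ ^ 7 / 200) ^ 4⌉₊ + 1, ?_⟩
  intro n hn t _ ht H hH hσ
  obtain ⟨σ, hσ⟩ := hσ
  have hn1 : (⌈40 / γ⌉₊ : ℝ) + ⌈100 / (γ ^ 7 / 200) ^ 4⌉₊ + 1 ≤ n := by exact_mod_cast hn
  have hnγ : 40 / γ ≤ n := by
    have h1 := Nat.le_ceil (40 / γ)
    have h2 : (0 : ℝ) ≤ ⌈100 / (γ ^ 7 / 200) ^ 4⌉₊ := Nat.cast_nonneg _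
    linarith
  have hnc : 100 / (γ ^ 7 / 200) ^ 4 < n := by
    have h1 := Nat.le_ceil (100 / (γ ^ 7 / 200) ^ 4)
    have h2 : (0 : ℝ) ≤ ⌈40 / γ⌉₊ := Nat.cast_nonneg _
    linarith
  rw [div_le_iff₀ hγ] at hnγ
  have hn0 : 0 < n := by omega
  have hn0' : (0 : ℝ) < n := by exact_mod_cast hn0
  obtain ⟨B, hBt, hB, hmin, v₀, hv₀⟩ := hσ.exists_low_set hγ hγ' hn0
  set L : Finset (Fin n) := univ.filter fun v => ((5 : ℝ) / 9) * (n.choose 2) ≤ (deg H v : ℝ)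
    with hL
  set m := ⌊γ ^ 4 * n / 6⌋₊ with hm
  have hm1 : (m : ℝ) ≤ γ ^ 4 * n / 6 := Nat.floor_le (by positivity)
  have hm2 : γ ^ 4 * n / 6 - 1 ≤ m := (Nat.sub_one_lt_floor _).le
  have hγ4 : γ ^ 4 ≤ γ / 16 := by
    have h1 : γ ^ 3 ≤ (1 / 2000) ^ 3 := pow_le_pow_left₀ hγ.le hγ' 3
    have h2 := mul_le_mul_of_nonneg_left h1 hγ.le
    nlinarith
  have hcount : ∀ U : Finset (Fin n), U.card ≤ 6 * m → ∀ x ∈ (univ ×ˢ L ×ˢ L),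
      γ ^ 3 / 8 * (n : ℝ) ^ 6 ≤ (((univ.filter (Gadget.Valid H)).filter fun ω =>
        Gadget.Absorbs H x ω ∧ Disjoint (Gadget.verts ω) U).card : ℝ) := by
    rintro U hU ⟨x, y, z⟩ hx
    simp only [mem_product, mem_univ, true_and] at hx
    have hUc : (U.card : ℝ) ≤ γ * n / 16 := by
      have h1 : (U.card : ℝ) ≤ 6 * m := by exact_mod_cast hU
      have h2 := mul_le_mul_of_nonneg_right hγ4 hn0'.le
      linarith
    exact card_absorbers_ge_of_degrees hγ hγ' hH hnγ B U x y z
      (le_trans (by exact_mod_cast hBt) ht) hB (hmin x) (mem_filter.1 hx.1).2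
      (mem_filter.1 hx.2).2 hUc
  have hv₀L : v₀ ∈ L := mem_filter.2 ⟨mem_univ _, hv₀⟩
  have hcardG : ((univ.filter (Gadget.Valid H)).card : ℝ) ≤ (n : ℝ) ^ 6 := by
    have h1 : (univ.filter (Gadget.Valid H)).card ≤ n ^ 6 := by
      refine (card_le_univ _).trans (le_of_eq ?_)
      simp only [Fintype.card_prod, Fintype.card_fin]
      ring
    exact_mod_cast h1
  obtain ⟨F, hFS, hFc, hFd, hFsum⟩ := exists_disjoint_family (univ.filter (Gadget.Valid H))
    (univ ×ˢ L ×ˢ L) ⟨(v₀, v₀, v₀), by simp [hv₀L]⟩ (Gadget.Absorbs H) Gadget.verts 6 m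
    (fun ω _ => Gadget.card_verts_le ω) (fun ω _ => Gadget.verts_nonempty ω)
    ((n : ℝ) ^ 6) (γ ^ 3 / 8) hcardG (by positivity) (by positivity) hcount m le_rfl
  have hFv : ∀ ω ∈ F, Gadget.Valid H ω := fun ω hω => (mem_filter.1 (hFS hω)).2
  obtain ⟨M, hM, hcov, hMc⟩ := exists_matching_of_family F hFv hFd
  refine ⟨M, hM, ?_, ?_⟩
  · have h1 : (M.card : ℝ) ≤ 2 * m := by
      rw [hFc] at hMc
      exact_mod_cast hMc
    linarith
  intro W hWM hW3 hWc hWL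
  obtain ⟨r, hr⟩ := hW3
  have hWL' : W.filter (fun v => ((5 : ℝ) / 9) * (n.choose 2) ≤ (deg H v : ℝ)) = W ∩ L := by
    ext v
    simp [hL]
  rw [hWL', hr] at hWL
  rw [hr] at hWc
  push_cast at hWL hWc
  have hlt := card_mul_pow_lt_half_pow (k := r) hγ hγ' hnc hm2 (by linarith)
  rw [hcov] at hWM ⊢
  refine exists_matching_absorbing hH L r F W hFv hFd ?_ hr ?_ ?_
  · intro ω hω
    rw [disjoint_left]
    intro v hv hvW
    exact (mem_sdiff.1 (hWM hvW)).2 (mem_biUnion.2 ⟨ω, hω, hv⟩)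
  · have : (2 * r : ℝ) ≤ (W ∩ L).card := by linarith
    exact_mod_cast this
  · intro x y hy z hz
    have h1 : (1 / 2 : ℝ) ^ (F.filter (Gadget.Absorbs H (x, y, z))).card ≤
        ∑ x ∈ univ ×ˢ L ×ˢ L, (1 / 2 : ℝ) ^ (F.filter (Gadget.Absorbs H x)).card :=
      single_le_sum (f := fun x => (1 / 2 : ℝ) ^ (F.filter (Gadget.Absorbs H x)).card)
        (fun _ _ => by positivity) (by simp [hy, hz])
    have h2 : (((univ : Finset (Fin n)) ×ˢ L ×ˢ L).card : ℝ) ≤ (n : ℝ) ^ 3 := by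
      have h3 : ((univ : Finset (Fin n)) ×ˢ L ×ˢ L).card ≤ n ^ 3 := by
        refine (card_le_univ _).trans (le_of_eq ?_)
        simp only [Fintype.card_prod, Fintype.card_fin]
        ring
      exact_mod_cast h3
    have h4 : 0 ≤ (1 - γ ^ 3 / 8 / 2) ^ m := by
      have : γ ^ 3 ≤ 1 := pow_le_one₀ hγ.le (by linarith)
      exact pow_nonneg (by linarith) _
    have h5 := lt_of_le_of_lt (h1.trans (hFsum.trans (mul_le_mul_of_nonneg_right h2 h4))) hlt
    exact ((pow_lt_pow_iff_right_of_lt_one₀ (by norm_num) (by norm_num)).1 h5).le
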